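/- For all n ≥ 0, the n-th symbolic power of 𝔭 is given explicitly by 𝔭^{(n)} = 𝓘ₙ = Σ_{n₁+2n₂=n} (f)^{n₂}·𝔭^{n₁}. -/

import Mathlib

open MvPolynomial

noncomputable def curveMap (k : Type*) [Field k] (q m : ℕ) :
    MvPolynomial (Fin 4) k →ₐ[k] MvPolynomial (Fin 2) k :=
  aeval ![X 0 ^ (2*q+1+2*m), X 0 ^ (2*q+1+m) * X 1 ^ m, X 0 ^ (2*q+1) * X 1 ^ (2*m),
    X 1 ^ (2*q+1+2*m)]

noncomputable def curveIdeal (k : Type*) [Field k] (q m : ℕ) : Ideal (MvPolynomial (Fin 4) k) :=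
  RingHom.ker (curveMap k q m)

instance (k : Type*) [Field k] (q m : ℕ) : (curveIdeal k q m).IsPrime :=
  RingHom.ker_isPrime _

noncomputable def symbPow (k : Type*) [Field k] (q m n : ℕ) :
    Ideal (MvPolynomial (Fin 4) k) :=
  (Ideal.map (algebraMap _ (Localization.AtPrime (curveIdeal k q m)))
      ((curveIdeal k q m) ^ n)).comap
    (algebraMap _ (Localization.AtPrime (curveIdeal k q m)))

noncomputable def fPoly (k : Type*) [Field k] (q m : ℕ) : MvPolynomial (Fin 4) k :=
  - X 2 ^ (2*(q+m)+1) - X 0 ^ (q-1) * X 1 ^ 3 * X 2 ^ (q+m-1) * X 3 ^ m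
    + 3 * X 0 ^ q * X 1 * X 2 ^ (q+m) * X 3 ^ m - X 0 ^ (2*q+1) * X 3 ^ (2*m)

noncomputable def moduleLength (R M : Type*) [Ring R] [AddCommGroup M] [Module R M] :
    WithBot ℕ∞ :=
  Order.krullDim (Submodule R M)

/-- `𝓘ₙ = Σ_{n₁+2n₂=n} (f)^{n₂}·𝔭^{n₁}`. -/
noncomputable def scriptI (k : Type*) [Field k] (q m n : ℕ) :
    Ideal (MvPolynomial (Fin 4) k) :=
  ⨆ (c : ℕ × ℕ) (_ : c.1 + 2 * c.2 = n),
    (Ideal.span {fPoly k q m}) ^ c.2 * (curveIdeal k q m) ^ c.1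

section helpers

variable (k : Type*) [Field k] (q m : ℕ)

noncomputable def pa : MvPolynomial (Fin 4) k := X 0 * X 2 - X 1 ^ 2

noncomputable def pb : MvPolynomial (Fin 4) k :=
  X 0 ^ (q+1) * X 3 ^ m - X 1 * X 2 ^ (q+m)

noncomputable def pc : MvPolynomial (Fin 4) k :=
  X 0 ^ q * X 1 * X 3 ^ m - X 2 ^ (q+m+1)

lemma rel1 : X 1 * pb k q m = X 2 ^ (q+m) * pa k + X 0 * pc k q m := by
  simp only [pa, pb, pc]; ring

lemma rel2 : X 1 * pc k q m = X 2 * pb k q m - X 0 ^ q * X 3 ^ m * pa k := by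
  simp only [pa, pb, pc]; ring

lemma rel3 (hq : 1 ≤ q) :
    pb k q m ^ 2 = X 2 ^ (q+m-1) * pa k * pc k q m - X 0 * fPoly k q m := by
  obtain ⟨Q, rfl⟩ := Nat.exists_eq_add_of_le' hq
  have : Q + 1 + m - 1 = Q + m := by omega
  simp only [pa, pb, pc, fPoly, this, Nat.add_sub_cancel]; ring

lemma rel4 (hq : 1 ≤ q) :
    X 1 * fPoly k q m = - (pb k q m * pc k q m)
      - X 0 ^ (q-1) * X 3 ^ m * X 2 ^ (q+m-1) * pa k ^ 2 := by
  obtain ⟨Q, rfl⟩ := Nat.exists_eq_add_of_le' hq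
  have : Q + 1 + m - 1 = Q + m := by omega
  simp only [pa, pb, pc, fPoly, this, Nat.add_sub_cancel]; ring

lemma rel5 (hq : 1 ≤ q) :
    pc k q m ^ 2 = - (X 2 * fPoly k q m)
      - X 0 ^ (q-1) * X 3 ^ m * (pa k * pb k q m) := by
  obtain ⟨Q, rfl⟩ := Nat.exists_eq_add_of_le' hq
  have : Q + 1 + m - 1 = Q + m := by omega
  simp only [pa, pb, pc, fPoly, this, Nat.add_sub_cancel]; ring

/-- monomials in the generators -/
noncomputable def mon (A i j l : ℕ) : MvPolynomial (Fin 4) k :=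
  pa k ^ A * pb k q m ^ i * pc k q m ^ j * fPoly k q m ^ l

noncomputable def KK (n : ℕ) : Ideal (MvPolynomial (Fin 4) k) :=
  Ideal.span {g | ∃ A i j l, A + i + j + 2 * l = n ∧ g = mon k q m A i j l}

lemma mon_mem {n A i j l : ℕ} (h : A + i + j + 2 * l = n) : mon k q m A i j l ∈ KK k q m n :=
  Ideal.subset_span ⟨A, i, j, l, h, rfl⟩

noncomputable def NN (n D : ℕ) : MvPolynomial (Fin 4) k :=
  if D ≤ 2 * n then
    mon k q m (D / 2) (D % 2) ((n - (D + 1) / 2) % 2) ((n - (D + 1) / 2) / 2)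
  else X 1 ^ (D - 2 * n) * pa k ^ n

lemma NN_mon {n D A i j l : ℕ} (hi : i ≤ 1) (hj : j ≤ 1) (hD : D = 2 * A + i)
    (hn : A + i + j + 2 * l = n) : NN k q m n D = mon k q m A i j l := by
  rw [NN, if_pos (by omega)]
  congr 1 <;> omega

lemma NN_big {n D : ℕ} (h : 2 * n ≤ D) : NN k q m n D = X 1 ^ (D - 2 * n) * pa k ^ n := by
  rw [NN]
  split_ifs with h'
  · obtain rfl : D = 2 * n := by omega
    have h1 : 2 * n / 2 = n := by omega
    have h2 : 2 * n % 2 = 0 := by omega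
    have h3 : n - (2 * n + 1) / 2 = 0 := by omega
    rw [h1, h2, h3]
    simp [mon]
  · rfl

lemma NN_small {n D : ℕ} (h : D < 2 * n) : ∃ A i j l, i ≤ 1 ∧ j ≤ 1 ∧ D = 2 * A + i ∧
    A + i + j + 2 * l = n ∧ (i = 1 ∨ j = 1 ∨ 1 ≤ l) :=
  ⟨D / 2, D % 2, (n - (D + 1) / 2) % 2, (n - (D + 1) / 2) / 2,
    by omega, by omega, by omega, by omega, by omega⟩

lemma NN_mem (n D : ℕ) : NN k q m n D ∈ KK k q m n := by
  by_cases h : D < 2 * n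
  · obtain ⟨A, i, j, l, hi, hj, hD, hn, -⟩ := NN_small h
    rw [NN_mon k q m hi hj hD hn]
    exact mon_mem k q m hn
  · rw [NN_big k q m (by omega)]
    refine Ideal.mul_mem_left _ _ ?_
    have := mon_mem k q m (n := n) (A := n) (i := 0) (j := 0) (l := 0) (by omega)
    simpa [mon] using this

/-- `I_n` is generated by the normal monomials. -/
lemma mon_mem_span (hq : 1 ≤ q) (d : ℕ) : ∀ A i j l n, i + j = d → A + i + j + 2 * l = n →
    mon k q m A i j l ∈ Ideal.span (Set.range (NN k q m n)) := by
  induction d using Nat.strong_induction_on with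
  | _ d ih =>
    intro A i j l n hd hn
    by_cases hi : 2 ≤ i
    · obtain ⟨i, rfl⟩ := Nat.exists_eq_add_of_le' hi
      have e : mon k q m A (i+2) j l = X 2 ^ (q+m-1) * mon k q m (A+1) i (j+1) l
          - X 0 * mon k q m A i j (l+1) := by
        simp only [mon, pow_add _ i 2, rel3 k q m hq]; ring
      rw [e]
      exact Ideal.sub_mem _
        (Ideal.mul_mem_left _ _ (ih (i+(j+1)) (by omega) _ _ _ _ _ rfl (by omega)))
        (Ideal.mul_mem_left _ _ (ih (i+j) (by omega) _ _ _ _ _ rfl (by omega)))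
    by_cases hj : 2 ≤ j
    · obtain ⟨j, rfl⟩ := Nat.exists_eq_add_of_le' hj
      have e : mon k q m A i (j+2) l = - (X 2 * mon k q m A i j (l+1))
          - X 0 ^ (q-1) * X 3 ^ m * mon k q m (A+1) (i+1) j l := by
        simp only [mon, pow_add _ j 2, rel5 k q m hq]; ring
      rw [e]
      exact Ideal.sub_mem _ (Ideal.neg_mem_iff _ |>.2
        (Ideal.mul_mem_left _ _ (ih (i+j) (by omega) _ _ _ _ _ rfl (by omega))))
        (Ideal.mul_mem_left _ _ (ih (i+1+j) (by omega) _ _ _ _ _ rfl (by omega)))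
    · refine Ideal.subset_span ⟨2 * A + i, ?_⟩
      exact NN_mon k q m (by omega) (by omega) rfl hn

lemma KK_le_span (hq : 1 ≤ q) (n : ℕ) : KK k q m n ≤ Ideal.span (Set.range (NN k q m n)) := by
  refine Ideal.span_le.2 ?_
  rintro _ ⟨A, i, j, l, h, rfl⟩
  exact mon_mem_span k q m hq _ A i j l n rfl h

noncomputable def iot : MvPolynomial (Fin 2) k →ₐ[k] MvPolynomial (Fin 4) k :=
  aeval ![X 2, X 3]

noncomputable def ppi : MvPolynomial (Fin 4) k →ₐ[k] Polynomial (MvPolynomial (Fin 2) k) :=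
  aeval ![0, Polynomial.X, Polynomial.C (X 0), Polynomial.C (X 1)]

lemma ppi_iot (c : MvPolynomial (Fin 2) k) : ppi k (iot k c) = Polynomial.C c := by
  have : (ppi k).comp (iot k) = (Polynomial.CAlgHom : _ →ₐ[k] _) := by
    apply MvPolynomial.algHom_ext
    intro i
    fin_cases i <;> simp [ppi, iot]
  exact DFunLike.congr_fun this c

/-- `W_n + x₁ I_n`. -/
noncomputable def ZZ (n : ℕ) : AddSubmonoid (MvPolynomial (Fin 4) k) where
  carrier := {g | ∃ γ : ℕ →₀ MvPolynomial (Fin 2) k, ∃ h ∈ KK k q m n,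
    g = γ.sum (fun D c => iot k c * NN k q m n D) + X 0 * h}
  zero_mem' := ⟨0, 0, Ideal.zero_mem _, by simp⟩
  add_mem' := by
    rintro _ _ ⟨γ, h, hh, rfl⟩ ⟨γ', h', hh', rfl⟩
    refine ⟨γ + γ', h + h', Ideal.add_mem _ hh hh', ?_⟩
    rw [Finsupp.sum_add_index' (by simp) (by intros; simp [add_mul])]
    ring

lemma ZZ_x0 {n : ℕ} {h} (hh : h ∈ KK k q m n) : X 0 * h ∈ ZZ k q m n :=
  ⟨0, h, hh, by simp⟩

lemma ZZ_NN (n D : ℕ) (c) : iot k c * NN k q m n D ∈ ZZ k q m n :=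
  ⟨Finsupp.single D c, 0, Ideal.zero_mem _, by simp⟩

lemma ZZ_le {n : ℕ} {g} (hg : g ∈ ZZ k q m n) : g ∈ KK k q m n := by
  obtain ⟨γ, h, hh, rfl⟩ := hg
  refine Ideal.add_mem _ ?_ (Ideal.mul_mem_left _ _ hh)
  exact Ideal.sum_mem _ fun D _ => Ideal.mul_mem_left _ _ (NN_mem k q m n D)

lemma ZZ_iot {n : ℕ} {g} (hg : g ∈ ZZ k q m n) (c) : iot k c * g ∈ ZZ k q m n := by
  obtain ⟨γ, h, hh, rfl⟩ := hg
  rw [mul_add, Finsupp.sum, Finset.mul_sum]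
  refine add_mem (sum_mem fun D _ => ?_) ?_
  · rw [← mul_assoc, ← map_mul]; exact ZZ_NN k q m n D _
  · rw [mul_left_comm]; exact ZZ_x0 k q m (Ideal.mul_mem_left _ _ hh)

lemma ZZ_x0pow {n : ℕ} {g} (hg : g ∈ ZZ k q m n) (e : ℕ) : X 0 ^ e * g ∈ ZZ k q m n := by
  induction e with
  | zero => simpa using hg
  | succ e ih => rw [pow_succ', mul_assoc]; exact ZZ_x0 k q m (ZZ_le k q m ih)

lemma iot0 : iot k (X 0) = X 2 := by simp [iot]
lemma iot1 : iot k (X 1) = X 3 := by simp [iot]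

lemma ZZ_NN' (n D : ℕ) : NN k q m n D ∈ ZZ k q m n := by
  simpa using ZZ_NN k q m n D 1

lemma ZZ_x1NN (hq : 1 ≤ q) (n D : ℕ) : X 1 * NN k q m n D ∈ ZZ k q m n := by
  by_cases h : D < 2 * n
  · obtain ⟨A, i, j, l, hi, hj, hD, hn, hor⟩ := NN_small h
    rw [NN_mon k q m hi hj hD hn]
    by_cases h1 : i = 1
    · subst h1
      have e : X 1 * mon k q m A 1 j l =
          iot k (X 0 ^ (q+m)) * mon k q m (A+1) 0 j l + X 0 * mon k q m A 0 (j+1) l := by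
        have := rel1 k q m
        rw [map_pow, iot0]
        simp only [mon]
        linear_combination (pa k ^ A * pc k q m ^ j * fPoly k q m ^ l) * this
      rw [e]
      refine add_mem (ZZ_iot k q m ?_ _) (ZZ_x0 k q m (mon_mem k q m (by omega)))
      rw [← NN_mon k q m (n := n) (D := D + 1) (by omega) hj (by omega) (by omega)]
      exact ZZ_NN' k q m _ _
    obtain rfl : i = 0 := by omega
    by_cases h2 : j = 1
    · subst h2
      have e : X 1 * mon k q m A 0 1 l =
          iot k (X 0) * mon k q m A 1 0 l
            + X 0 * (- (X 0 ^ (q-1) * X 3 ^ m) * mon k q m (A+1) 0 0 l) := by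
        have := rel2 k q m
        have hp : (X 0 : MvPolynomial (Fin 4) k) ^ q = X 0 * X 0 ^ (q-1) := by
          rw [← pow_succ']; congr 1; omega
        rw [hp] at this
        rw [iot0]
        simp only [mon]
        linear_combination (pa k ^ A * fPoly k q m ^ l) * this
      rw [e]
      refine add_mem (ZZ_iot k q m ?_ _)
        (ZZ_x0 k q m (Ideal.mul_mem_left _ _ (mon_mem k q m (by omega))))
      rw [← NN_mon k q m (n := n) (D := D + 1) (by omega) (by omega) (by omega) (by omega)]
      exact ZZ_NN' k q m _ _
    obtain rfl : j = 0 := by omega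
    obtain ⟨l, rfl⟩ := Nat.exists_eq_add_of_le' (show 1 ≤ l by omega)
    have e : X 1 * mon k q m A 0 0 (l+1) =
        iot k (-1) * mon k q m A 1 1 l
          + X 0 ^ (q-1) * (iot k (- (X 1 ^ m * X 0 ^ (q+m-1))) * mon k q m (A+2) 0 0 l) := by
      have := rel4 k q m hq
      simp only [map_neg, map_mul, map_pow, iot0, iot1, map_one]
      simp only [mon]
      linear_combination (pa k ^ A * fPoly k q m ^ l) * this
    rw [e]
    refine add_mem (ZZ_iot k q m ?_ _) (ZZ_x0pow k q m (ZZ_iot k q m ?_ _) _)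
    · rw [← NN_mon k q m (n := n) (D := D + 1) (by omega) (by omega) (by omega) (by omega)]
      exact ZZ_NN' k q m _ _
    · rw [← NN_mon k q m (n := n) (D := D + 4) (by omega) (by omega) (by omega) (by omega)]
      exact ZZ_NN' k q m _ _
  · have : X 1 * NN k q m n D = NN k q m n (D + 1) := by
      rw [NN_big k q m (by omega), NN_big k q m (by omega), ← mul_assoc, ← pow_succ']
      congr 2; omega
    rw [this]
    exact ZZ_NN' k q m _ _

lemma ZZ_x1 (hq : 1 ≤ q) {n : ℕ} {g} (hg : g ∈ ZZ k q m n) : X 1 * g ∈ ZZ k q m n := by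
  obtain ⟨γ, h, hh, rfl⟩ := hg
  rw [mul_add, Finsupp.sum, Finset.mul_sum]
  refine add_mem (sum_mem fun D _ => ?_) ?_
  · rw [mul_left_comm]; exact ZZ_iot k q m (ZZ_x1NN k q m hq n D) _
  · rw [mul_left_comm]; exact ZZ_x0 k q m (Ideal.mul_mem_left _ _ hh)

lemma ZZ_mul (hq : 1 ≤ q) {n : ℕ} (r : MvPolynomial (Fin 4) k) :
    ∀ g ∈ ZZ k q m n, r * g ∈ ZZ k q m n := by
  induction r using MvPolynomial.induction_on with
  | C a =>
    intro g hg
    have : (C a : MvPolynomial (Fin 4) k) = iot k (C a) := by simp [iot, algebraMap_eq]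
    rw [this]
    exact ZZ_iot k q m hg _
  | add p p' hp hp' => intro g hg; rw [add_mul]; exact add_mem (hp g hg) (hp' g hg)
  | mul_X p i hp =>
    intro g hg
    rw [mul_assoc]
    refine hp _ ?_
    fin_cases i
    · exact ZZ_x0 k q m (ZZ_le k q m hg)
    · exact ZZ_x1 k q m hq hg
    · have := ZZ_iot k q m hg (X 0); rwa [iot0] at this
    · have := ZZ_iot k q m hg (X 1); rwa [iot1] at this

lemma KK_le_ZZ (hq : 1 ≤ q) {n : ℕ} {g} (hg : g ∈ KK k q m n) : g ∈ ZZ k q m n := by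
  have := KK_le_span k q m hq n hg
  clear hg
  induction this using Submodule.span_induction with
  | mem x hx => obtain ⟨D, rfl⟩ := hx; exact ZZ_NN' k q m n D
  | zero => exact zero_mem _
  | add x y _ _ hx hy => exact add_mem hx hy
  | smul r x _ hx => exact ZZ_mul k q m hq r x hx

lemma triangular {A : Type*} [CommRing A] [IsDomain A] (g h : ℕ → Polynomial A)
    (hg : ∀ D, g D = Polynomial.X ^ D * h D) (hh : ∀ D, (h D).coeff 0 ≠ 0)
    (γ : ℕ →₀ A) (h0 : γ.sum (fun D c => Polynomial.C c * g D) = 0) : γ = 0 := by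
  ext D
  induction D using Nat.strong_induction_on with
  | _ D ih =>
    have h1 := congrArg (fun p => Polynomial.coeff p D) h0
    simp only [Finsupp.sum, Polynomial.finsetSum_coeff, Polynomial.coeff_zero] at h1
    rw [Finset.sum_eq_single D] at h1
    · rw [Polynomial.coeff_C_mul, hg, Polynomial.coeff_X_pow_mul', if_pos le_rfl, Nat.sub_self] at h1
      simpa [hh D] using h1
    · intro E _ hE
      rcases lt_or_gt_of_ne hE with h | h
      · rw [ih E h]; simp
      · rw [Polynomial.coeff_C_mul, hg, Polynomial.coeff_X_pow_mul', if_neg (by omega), mul_zero]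
    · intro hD
      rw [Finsupp.notMem_support_iff.1 hD]; simp

lemma ppi_a : ppi k (pa k) = - Polynomial.X ^ 2 := by simp [ppi, pa]

lemma ppi_b : ppi k (pb k q m) = - (Polynomial.X * Polynomial.C (X 0 : MvPolynomial (Fin 2) k) ^ (q+m)) := by
  simp [ppi, pb]

lemma ppi_c (hq : 1 ≤ q) : ppi k (pc k q m) = - Polynomial.C (X 0 : MvPolynomial (Fin 2) k) ^ (q+m+1) := by
  simp [ppi, pc, zero_pow (show q ≠ 0 by omega)]

lemma ppi_f_coeff (hq : 1 ≤ q) : (ppi k (fPoly k q m)).eval 0 ≠ 0 := by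
  simp [ppi, fPoly, zero_pow (show q ≠ 0 by omega)]

lemma ppi_NN (hq : 1 ≤ q) (n D : ℕ) : ∃ h : Polynomial (MvPolynomial (Fin 2) k),
    ppi k (NN k q m n D) = Polynomial.X ^ D * h ∧ h.coeff 0 ≠ 0 := by
  by_cases h : D < 2 * n
  · obtain ⟨A, i, j, l, hi, hj, hD, hn, -⟩ := NN_small h
    refine ⟨(-1) ^ A * (- Polynomial.C (X 0 : MvPolynomial (Fin 2) k) ^ (q+m)) ^ i * (- Polynomial.C (X 0 : MvPolynomial (Fin 2) k) ^ (q+m+1)) ^ j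
      * (ppi k (fPoly k q m)) ^ l, ?_, ?_⟩
    · rw [NN_mon k q m hi hj hD hn, mon]
      simp only [map_mul, map_pow, ppi_a, ppi_b, ppi_c k q m hq]
      have e1 : (-Polynomial.X ^ 2 : Polynomial (MvPolynomial (Fin 2) k)) =
        Polynomial.X ^ 2 * (-1) := by ring
      have e2 : (-(Polynomial.X * Polynomial.C (X 0 : MvPolynomial (Fin 2) k) ^ (q+m))) =
        Polynomial.X * (- Polynomial.C (X 0 : MvPolynomial (Fin 2) k) ^ (q+m)) := by ring
      rw [hD, e1, e2, mul_pow, mul_pow, ← pow_mul]; ring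
    · rw [Polynomial.coeff_zero_eq_eval_zero]
      have := ppi_f_coeff k q m hq
      simp [this]
  · refine ⟨(-1) ^ n, ?_, ?_⟩
    · rw [NN_big k q m (by omega)]
      simp only [map_mul, map_pow, ppi_a]
      have : ppi k (X 1) = Polynomial.X := by simp [ppi]
      have e1 : (-Polynomial.X ^ 2 : Polynomial (MvPolynomial (Fin 2) k)) =
        Polynomial.X ^ 2 * (-1) := by ring
      rw [this, e1, mul_pow, ← pow_mul, ← mul_assoc, ← pow_add]
      congr 2; omega
    · rw [Polynomial.coeff_zero_eq_eval_zero]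
      simp

lemma cancel_x0 (hq : 1 ≤ q) (n : ℕ) (g) (hg : X 0 * g ∈ KK k q m n) : g ∈ KK k q m n := by
  obtain ⟨γ, h, hh, e⟩ := KK_le_ZZ k q m hq hg
  choose H hH hH0 using ppi_NN k q m hq n
  have hx : ppi k (X 0) = 0 := by simp [ppi]
  have e2 := congrArg (ppi k) e
  simp only [map_add, map_mul, hx, zero_mul, add_zero, Finsupp.sum, map_sum, ppi_iot] at e2
  have : γ = 0 := triangular (fun D => ppi k (NN k q m n D)) H hH hH0 γ e2.symm
  subst this
  simp only [Finsupp.sum_zero_index, zero_add] at e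
  rw [mul_left_cancel₀ (X_ne_zero 0) e]
  exact hh

lemma cancel_pow (hq : 1 ≤ q) (N n : ℕ) (g) (hg : X 0 ^ N * g ∈ KK k q m n) :
    g ∈ KK k q m n := by
  induction N with
  | zero => simpa using hg
  | succ N ih => 
    rw [pow_succ', mul_assoc] at hg
    exact ih (cancel_x0 k q m hq n _ hg)

/-! Generators of the curve ideal. -/

noncomputable def NV (t : ℕ × Fin (2*(q+m)+1) × ℕ) : MvPolynomial (Fin 4) k :=
  X 0 ^ t.1 * X 1 ^ (t.2.1.val % 2) * X 2 ^ (t.2.1.val / 2) * X 3 ^ t.2.2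

noncomputable def expo (t : ℕ × Fin (2*(q+m)+1) × ℕ) : Fin 2 →₀ ℕ :=
  Finsupp.single 0 ((2*q+1+2*m) * t.1 + (2*q+1+m) * (t.2.1.val % 2) + (2*q+1) * (t.2.1.val / 2))
  + Finsupp.single 1 (m * t.2.1.val + (2*q+1+2*m) * t.2.2)

lemma expo_inj (hco : Nat.Coprime (2*q+1) m) : Function.Injective (expo q m) := by
  rintro ⟨i, ⟨r, hr⟩, l⟩ ⟨i', ⟨r', hr'⟩, l'⟩ h
  have h0 := DFunLike.congr_fun h 0
  have h1 := DFunLike.congr_fun h 1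
  simp only [expo, Finsupp.add_apply, Finsupp.single_apply] at h0 h1
  simp at h0 h1
  have hc : Nat.Coprime (2*q+1+2*m) m := by simpa using hco
  have hmod : m * r ≡ m * r' [MOD (2*q+1+2*m)] := by
    have := congrArg (fun x => x % (2*q+1+2*m)) h1
    simpa [Nat.ModEq] using this
  have hmod' := Nat.ModEq.cancel_left_of_coprime hc hmod
  have hrr : r = r' := Nat.ModEq.eq_of_lt_of_lt hmod' (by omega) (by omega)
  subst hrr
  have hl : l = l' := Nat.eq_of_mul_eq_mul_left (show 0 < 2*q+1+2*m by omega) (by omega)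
  have hi : i = i' := Nat.eq_of_mul_eq_mul_left (show 0 < 2*q+1+2*m by omega) (by omega)
  subst hl hi
  rfl

lemma curveMap_NV (t) : curveMap k q m (NV k q m t) = monomial (expo q m t) 1 := by
  obtain ⟨i, ⟨r, hr⟩, l⟩ := t
  have hx : ∀ a b : ℕ, (monomial (Finsupp.single (0 : Fin 2) a + Finsupp.single 1 b) (1 : k))
      = X 0 ^ a * X 1 ^ b := by
    intro a b
    rw [X_pow_eq_monomial, X_pow_eq_monomial, monomial_mul, one_mul]
  rw [expo, hx, NV]
  simp only [curveMap, map_mul, map_pow, aeval_X]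
  simp only [Matrix.cons_val]
  have e : m * r = m * (r % 2) + 2 * m * (r / 2) := by
    conv_lhs => rw [← Nat.mod_add_div r 2]
    ring
  rw [e]
  simp only [mul_pow, ← pow_mul, pow_add]
  ring

lemma NV_disj (hco : Nat.Coprime (2*q+1) m) :
    Disjoint (Submodule.span k (Set.range (NV k q m))) (LinearMap.ker (curveMap k q m).toLinearMap) := by
  apply Submodule.range_ker_disjoint
  have : ((curveMap k q m).toLinearMap ∘ NV k q m) = (basisMonomials (Fin 2) k) ∘ expo q m := by
    funext t
    simp [curveMap_NV]
  rw [this]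
  exact (basisMonomials (Fin 2) k).linearIndependent.comp _ (expo_inj q m hco)

noncomputable def PP : Ideal (MvPolynomial (Fin 4) k) := Ideal.span {pa k, pb k q m, pc k q m}

lemma pa_mem : pa k ∈ PP k q m := Ideal.subset_span (by simp)
lemma pb_mem : pb k q m ∈ PP k q m := Ideal.subset_span (by simp)
lemma pc_mem : pc k q m ∈ PP k q m := Ideal.subset_span (by simp)

noncomputable def VV : Submodule k (MvPolynomial (Fin 4) k) :=
  Submodule.span k (Set.range (NV k q m)) ⊔ (PP k q m).restrictScalars k

lemma NV_mem_VV (i r l : ℕ) (hr : r < 2*(q+m)+1) :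
    X 0 ^ i * X 1 ^ (r % 2) * X 2 ^ (r / 2) * X 3 ^ l ∈ VV k q m :=
  Submodule.mem_sup_left (Submodule.subset_span ⟨(i, ⟨r, hr⟩, l), rfl⟩)

lemma PP_le_VV {g} (h : g ∈ PP k q m) : g ∈ VV k q m := Submodule.mem_sup_right h

lemma VV_NV0 (t) : X 0 * NV k q m t ∈ VV k q m := by
  obtain ⟨i, ⟨r, hr⟩, l⟩ := t
  have := NV_mem_VV k q m (i+1) r l hr
  convert this using 1
  simp only [NV]; ring

lemma VV_NV3 (t) : X 3 * NV k q m t ∈ VV k q m := by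
  obtain ⟨i, ⟨r, hr⟩, l⟩ := t
  have := NV_mem_VV k q m i r (l+1) hr
  convert this using 1
  simp only [NV]; ring

lemma VV_NV1 (hq : 1 ≤ q) (t) : X 1 * NV k q m t ∈ VV k q m := by
  obtain ⟨i, ⟨r, hr⟩, l⟩ := t
  simp only [NV]
  obtain ⟨j, rfl | rfl⟩ := Nat.even_or_odd' r
  · have e1 : 2 * j % 2 = 0 := by omega
    have e2 : 2 * j / 2 = j := by omega
    rw [e1, e2]
    by_cases hj : j < q + m
    · have := NV_mem_VV k q m i (2*j+1) l (by omega)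
      rw [show (2*j+1)%2 = 1 by omega, show (2*j+1)/2 = j by omega] at this
      convert this using 1
      ring
    · obtain rfl : j = q + m := by omega
      have h1 := NV_mem_VV k q m (i+q+1) 0 (l+m) (by omega)
      have h2 := PP_le_VV k q m (Ideal.mul_mem_left _ (-(X 0 ^ i * X 3 ^ l)) (pb_mem k q m))
      convert add_mem h1 h2 using 1
      simp only [pb]; simp; ring
  · have e1 : (2 * j + 1) % 2 = 1 := by omega
    have e2 : (2 * j + 1) / 2 = j := by omega
    rw [e1, e2]
    have h1 := NV_mem_VV k q m (i+1) (2*(j+1)) l (by omega)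
    rw [show (2*(j+1))%2 = 0 by omega, show (2*(j+1))/2 = j+1 by omega] at h1
    have h2 := PP_le_VV k q m (Ideal.mul_mem_left _ (-(X 0 ^ i * X 2 ^ j * X 3 ^ l)) (pa_mem k q m))
    convert add_mem h1 h2 using 1
    simp only [pa]; ring

lemma VV_NV2 (hq : 1 ≤ q) (t) : X 2 * NV k q m t ∈ VV k q m := by
  obtain ⟨i, ⟨r, hr⟩, l⟩ := t
  simp only [NV]
  by_cases hr2 : r + 2 < 2*(q+m)+1
  · have := NV_mem_VV k q m i (r+2) l hr2
    rw [show (r+2)%2 = r%2 by omega, show (r+2)/2 = r/2+1 by omega] at this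
    convert this using 1
    ring
  · by_cases hr3 : r = 2*(q+m)
    · subst hr3
      rw [show 2*(q+m)%2 = 0 by omega, show 2*(q+m)/2 = q+m by omega]
      have h1 := NV_mem_VV k q m (i+q) 1 (l+m) (by omega)
      have h2 := PP_le_VV k q m (Ideal.mul_mem_left _ (-(X 0 ^ i * X 3 ^ l)) (pc_mem k q m))
      convert add_mem h1 h2 using 1
      simp only [pc]; simp; ring
    · obtain ⟨j, hj⟩ : ∃ j, q + m = j + 1 := ⟨q+m-1, by omega⟩
      rw [show r%2 = 1 by omega, show r/2 = j by omega]
      have h1 := NV_mem_VV k q m (i+q+1) 0 (l+m) (by omega)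
      have h2 := PP_le_VV k q m (Ideal.mul_mem_left _ (-(X 0 ^ i * X 3 ^ l)) (pb_mem k q m))
      convert add_mem h1 h2 using 1
      simp only [pb, hj]; simp; ring

lemma VV_X (hq : 1 ≤ q) (i : Fin 4) {g} (hg : g ∈ VV k q m) : X i * g ∈ VV k q m := by
  obtain ⟨v, hv, p, hp, rfl⟩ := Submodule.mem_sup.1 hg
  rw [mul_add]
  refine add_mem ?_ (PP_le_VV k q m (Ideal.mul_mem_left _ _ hp))
  clear hg hp
  induction hv using Submodule.span_induction with
  | mem x hx =>
    obtain ⟨t, rfl⟩ := hx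
    fin_cases i
    · exact VV_NV0 k q m t
    · exact VV_NV1 k q m hq t
    · exact VV_NV2 k q m hq t
    · exact VV_NV3 k q m t
  | zero => simp
  | add x y _ _ hx hy => rw [mul_add]; exact add_mem hx hy
  | smul r x _ hx => rw [mul_smul_comm]; exact Submodule.smul_mem _ _ hx

lemma VV_top (hq : 1 ≤ q) (g) : g ∈ VV k q m := by
  induction g using MvPolynomial.induction_on with
  | C a =>
    have := Submodule.smul_mem _ a (NV_mem_VV k q m 0 0 0 (by omega))
    simpa [smul_eq_C_mul] using this
  | add p p' hp hp' => exact add_mem hp hp'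
  | mul_X p i hp => rw [mul_comm]; exact VV_X k q m hq i hp

lemma PP_le : PP k q m ≤ curveIdeal k q m := by
  refine Ideal.span_le.2 ?_
  have ha : ∀ i, curveMap k q m (X i) = (![X 0 ^ (2*q+1+2*m), X 0 ^ (2*q+1+m) * X 1 ^ m,
    X 0 ^ (2*q+1) * X 1 ^ (2*m), X 1 ^ (2*q+1+2*m)] : Fin 4 → MvPolynomial (Fin 2) k) i := by
    intro i; simp [curveMap]
  rintro _ (rfl | rfl | rfl) <;>
  · change curveMap k q m _ = 0
    simp only [pa, pb, pc, map_sub, map_mul, map_pow, ha, Matrix.cons_val]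
    ring

lemma curveIdeal_eq (hq : 1 ≤ q) (hco : Nat.Coprime (2*q+1) m) :
    curveIdeal k q m = PP k q m := by
  refine le_antisymm ?_ (PP_le k q m)
  intro g hg
  obtain ⟨v, hv, p, hp, rfl⟩ := Submodule.mem_sup.1 (VV_top k q m hq g)
  have hp' : p ∈ PP k q m := hp
  have h1 : v ∈ curveIdeal k q m := (Ideal.add_mem_iff_left _ (PP_le k q m hp')).1 hg
  have h2 : v = 0 := Submodule.disjoint_def.1 (NV_disj k q m hco) v hv h1
  rw [h2, zero_add]; exact hp'

/-! `scriptI = KK` -/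

lemma KK_mul_PP (n : ℕ) : KK k q m n * PP k q m ≤ KK k q m (n+1) := by
  rw [KK, PP, Ideal.span_mul_span', Ideal.span_le]
  rintro _ ⟨_, ⟨A, i, j, l, h, rfl⟩, _, (rfl | rfl | rfl), rfl⟩
  · have := mon_mem k q m (show (A+1)+i+j+2*l = n+1 by omega)
    rw [SetLike.mem_coe]
    convert this using 1
    simp only [mon]; ring
  · have := mon_mem k q m (show A+(i+1)+j+2*l = n+1 by omega)
    rw [SetLike.mem_coe]
    convert this using 1
    simp only [mon]; ring
  · have := mon_mem k q m (show A+i+(j+1)+2*l = n+1 by omega)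
    rw [SetLike.mem_coe]
    convert this using 1
    simp only [mon]; ring

lemma KK_mul_PP_pow (n e : ℕ) : KK k q m n * PP k q m ^ e ≤ KK k q m (n+e) := by
  induction e with
  | zero => simp
  | succ e ih =>
    rw [pow_succ, ← mul_assoc]
    exact (Ideal.mul_mono_left ih).trans (KK_mul_PP k q m _)

lemma scriptI_eq (hq : 1 ≤ q) (hm : 1 ≤ m) (hco : Nat.Coprime (2*q+1) m) (n : ℕ) :
    scriptI k q m n = KK k q m n := by
  apply le_antisymm
  · refine iSup₂_le ?_
    rintro ⟨e, l⟩ hc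
    simp only at hc ⊢
    rw [curveIdeal_eq k q m hq hco, Ideal.span_singleton_pow]
    have h1 : Ideal.span {fPoly k q m ^ l} ≤ KK k q m (2*l) := by
      rw [Ideal.span_singleton_le_iff_mem]
      have := mon_mem k q m (show 0+0+0+2*l = 2*l by omega)
      simpa [mon] using this
    refine (Ideal.mul_mono_left h1).trans ((KK_mul_PP_pow k q m _ _).trans ?_)
    rw [show 2*l+e = n by omega]
  · refine Ideal.span_le.2 ?_
    rintro _ ⟨A, i, j, l, h, rfl⟩
    refine (le_iSup₂_of_le (f := fun (c : ℕ × ℕ) (_ : c.1 + 2 * c.2 = n) =>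
      (Ideal.span {fPoly k q m}) ^ c.2 * (curveIdeal k q m) ^ c.1) (A+i+j, l) h le_rfl) ?_
    have hP := PP_le k q m
    rw [mon, mul_comm _ (fPoly k q m ^ l)]
    change _ ∈ Ideal.span {fPoly k q m} ^ l * curveIdeal k q m ^ (A+i+j)
    refine Ideal.mul_mem_mul (Ideal.pow_mem_pow (Ideal.mem_span_singleton_self _) _) ?_
    simp only [pow_add]
    exact Ideal.mul_mem_mul (Ideal.mul_mem_mul (Ideal.pow_mem_pow (hP (pa_mem k q m)) _)
      (Ideal.pow_mem_pow (hP (pb_mem k q m)) _)) (Ideal.pow_mem_pow (hP (pc_mem k q m)) _)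

lemma pow_le_scriptI (n : ℕ) : curveIdeal k q m ^ n ≤ scriptI k q m n := by
  refine (le_iSup₂_of_le (f := fun (c : ℕ × ℕ) (_ : c.1 + 2 * c.2 = n) =>
      (Ideal.span {fPoly k q m}) ^ c.2 * (curveIdeal k q m) ^ c.1) (n, 0) (by simp) ?_)
  simp

/-! Symbolic powers -/

lemma mem_symbPow (n : ℕ) (g) : g ∈ symbPow k q m n ↔
    ∃ s, s ∉ curveIdeal k q m ∧ s * g ∈ curveIdeal k q m ^ n := by
  rw [symbPow, Ideal.mem_comap,
    IsLocalization.algebraMap_mem_map_algebraMap_iff (curveIdeal k q m).primeCompl]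
  rfl

lemma x0_notMem : (X 0 : MvPolynomial (Fin 4) k) ∉ curveIdeal k q m := by
  intro h
  have h : curveMap k q m (X 0) = 0 := h
  simp [curveMap] at h

lemma scriptI_le (hq : 1 ≤ q) (hm : 1 ≤ m) (n : ℕ) : scriptI k q m n ≤ symbPow k q m n := by
  refine iSup₂_le ?_
  rintro ⟨e, l⟩ hc
  simp only at hc ⊢
  have hP := PP_le k q m
  rw [Ideal.span_singleton_pow]
  intro g hg
  obtain ⟨y, hy, rfl⟩ := Ideal.mem_span_singleton_mul.1 hg
  rw [mem_symbPow]
  refine ⟨X 0 ^ l, fun h => x0_notMem k q m (Ideal.IsPrime.mem_of_pow_mem inferInstance _ h), ?_⟩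
  have hf : X 0 * fPoly k q m ∈ curveIdeal k q m ^ 2 := by
    have := rel3 k q m hq
    have e : X 0 * fPoly k q m = X 2 ^ (q+m-1) * (pa k * pc k q m) - pb k q m ^ 2 := by
      linear_combination this
    rw [e]
    refine Ideal.sub_mem _ (Ideal.mul_mem_left _ _ ?_) (Ideal.pow_mem_pow (hP (pb_mem k q m)) 2)
    rw [pow_two]
    exact Ideal.mul_mem_mul (hP (pa_mem k q m)) (hP (pc_mem k q m))
  rw [← mul_assoc, ← mul_pow, ← hc, add_comm, pow_add, pow_mul]
  exact Ideal.mul_mem_mul (Ideal.pow_mem_pow hf l) hy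

lemma pa_prime : Prime (pa k) := by
  rw [← irreducible_iff_prime]
  have e : pa k = X 0 * X 2 + -X 1 ^ 2 := by simp only [pa]; ring
  rw [e]
  refine MvPolynomial.irreducible_mul_X_add (R := k) (X 0 : MvPolynomial (Fin 4) k) (-X 1 ^ 2) 2
    (X_ne_zero 0) (by rw [vars_X]; decide) ?_ ?_
  · intro h
    rw [vars_neg] at h
    have := vars_pow _ _ h
    rw [vars_X] at this
    revert this; decide
  · refine IsRelPrime.neg_right (IsRelPrime.pow_right ?_)
    rw [(X_prime (R := k) (i := (0 : Fin 4))).irreducible.isRelPrime_iff_not_dvd, X_dvd_X]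
    decide

lemma pa_not_dvd_pb (hm : 1 ≤ m) : ¬ pa k ∣ pb k q m := by
  intro h
  have := map_dvd (aeval (![1, 1, 1, 0] : Fin 4 → k)) h
  simp [pa, pb, zero_pow (show m ≠ 0 by omega)] at this

noncomputable def JJ : Ideal (MvPolynomial (Fin 4) k) := Ideal.span {pa k, pb k q m}

lemma JJ_le : JJ k q m ≤ curveIdeal k q m :=
  (Ideal.span_mono (by intro x; simp; tauto)).trans (PP_le k q m)

lemma paJ : pa k ∈ JJ k q m := Ideal.subset_span (by simp)
lemma pbJ : pb k q m ∈ JJ k q m := Ideal.subset_span (by simp)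

lemma JJ_pow_le (n : ℕ) : JJ k q m ^ (n+1) ≤
    Ideal.span {pa k} * JJ k q m ^ n ⊔ Ideal.span {pb k q m} ^ (n+1) := by
  have hJ : JJ k q m = Ideal.span {pa k} ⊔ Ideal.span {pb k q m} := by
    rw [JJ, Ideal.span_insert]
  induction n with
  | zero => simp [hJ]
  | succ n ih =>
    conv_lhs => rw [pow_succ']
    nth_rw 1 [hJ]
    rw [Ideal.sup_mul]
    refine sup_le le_sup_left ?_
    refine (Ideal.mul_mono_right ih).trans ?_
    rw [Ideal.mul_sup, ← pow_succ']
    refine sup_le_sup_right ?_ _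
    rw [mul_left_comm, pow_succ']
    refine Ideal.mul_mono_right (Ideal.mul_mono_left ?_)
    rw [hJ]; exact le_sup_right

lemma JJ_pow_mem {n : ℕ} {g} (hg : g ∈ JJ k q m ^ (n+1)) :
    ∃ y ∈ JJ k q m ^ n, ∃ h, g = pa k * y + pb k q m ^ (n+1) * h := by
  obtain ⟨u, hu, v, hv, rfl⟩ := Submodule.mem_sup.1 (JJ_pow_le k q m n hg)
  obtain ⟨y, hy, rfl⟩ := Ideal.mem_span_singleton_mul.1 hu
  rw [Ideal.span_singleton_pow] at hv
  obtain ⟨h, rfl⟩ := Ideal.mem_span_singleton.1 hv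
  exact ⟨y, hy, h, rfl⟩

lemma x0_mul_mem (hq : 1 ≤ q) (hco : Nat.Coprime (2*q+1) m) {g} (hg : g ∈ curveIdeal k q m) :
    X 0 * g ∈ JJ k q m := by
  rw [curveIdeal_eq k q m hq hco] at hg
  induction hg using Submodule.span_induction with
  | mem x hx =>
    rcases hx with rfl | rfl | rfl
    · exact Ideal.mul_mem_left _ _ (paJ k q m)
    · exact Ideal.mul_mem_left _ _ (pbJ k q m)
    · have e : X 0 * pc k q m = X 1 * pb k q m - X 2 ^ (q+m) * pa k := by
        rw [rel1]; ring
      rw [e]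
      exact Ideal.sub_mem _ (Ideal.mul_mem_left _ _ (pbJ k q m)) (Ideal.mul_mem_left _ _ (paJ k q m))
  | zero => simp
  | add x y _ _ hx hy => rw [mul_add]; exact add_mem hx hy
  | smul r x _ hx => rw [smul_eq_mul, mul_left_comm]; exact Ideal.mul_mem_left _ _ hx

lemma x0_pow_mul_mem (hq : 1 ≤ q) (hco : Nat.Coprime (2*q+1) m) (n : ℕ) :
    ∀ {g}, g ∈ curveIdeal k q m ^ n → X 0 ^ n * g ∈ JJ k q m ^ n := by
  induction n with
  | zero => intro g _; simp
  | succ n ih =>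
    intro g hg
    rw [pow_succ] at hg
    induction hg using Submodule.mul_induction_on' with
    | mem_mul_mem x hx y hy =>
      have e : X 0 ^ (n+1) * (x * y) = (X 0 ^ n * x) * (X 0 * y) := by ring
      rw [e, pow_succ]
      exact Ideal.mul_mem_mul (ih hx) (x0_mul_mem k q m hq hco hy)
    | add x _ y _ hx hy => rw [mul_add]; exact add_mem hx hy

lemma sat_J (hq : 1 ≤ q) (hm : 1 ≤ m) (hco : Nat.Coprime (2*q+1) m) (n : ℕ) :
    ∀ s g, s ∉ curveIdeal k q m → s * g ∈ JJ k q m ^ n → ∃ N, X 0 ^ N * g ∈ JJ k q m ^ n := by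
  have hprime : (curveIdeal k q m).IsPrime := inferInstance
  have key : ∀ s h, s ∉ curveIdeal k q m → s * h ∈ JJ k q m → X 0 * h ∈ JJ k q m := by
    intro s h hs hsh
    exact x0_mul_mem k q m hq hco ((hprime.mem_or_mem (JJ_le k q m hsh)).resolve_left hs)
  induction n with
  | zero => intro s g _ _; exact ⟨0, by simp⟩
  | succ n ih =>
    intro s g hs hsg
    cases n with
    | zero =>
      rw [zero_add, pow_one] at hsg ⊢
      exact ⟨1, by rw [pow_one]; exact key s g hs hsg⟩
    | succ n =>
      obtain ⟨N, hN⟩ := ih s g hs (Ideal.pow_le_pow_right (Nat.le_succ _) hsg)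
      obtain ⟨y, hy, h, e⟩ := JJ_pow_mem k q m hN
      obtain ⟨y', hy', h', e'⟩ := JJ_pow_mem k q m (Ideal.mul_mem_left _ (X 0 ^ N) hsg)
      have e1 : pb k q m ^ (n+1) * (s * h - pb k q m * h') = pa k * (y' - s * y) := by
        linear_combination (-s) * e + e'
      have hd : pa k ∣ s * h - pb k q m * h' := by
        rcases (pa_prime k).dvd_or_dvd ⟨_, e1⟩ with hh | hh
        · exact absurd ((pa_prime k).dvd_of_dvd_pow hh) (pa_not_dvd_pb k q m hm)
        · exact hh
      obtain ⟨t, ht⟩ := hd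
      have h1 : X 0 * h ∈ JJ k q m := by
        refine key s h hs ?_
        have : s * h = h' * pb k q m + t * pa k := by linear_combination ht
        rw [this]
        exact Ideal.add_mem _ (Ideal.mul_mem_left _ _ (pbJ k q m))
          (Ideal.mul_mem_left _ _ (paJ k q m))
      have h2 : s * y ∈ JJ k q m ^ (n+1) := by
        have : pa k * (s * y) = pa k * (y' - pb k q m ^ (n+1) * t) := by
          rw [ht] at e1
          linear_combination e1
        rw [mul_left_cancel₀ (pa_prime k).ne_zero this]
        exact Ideal.sub_mem _ hy' (Ideal.mul_mem_right _ _ (Ideal.pow_mem_pow (pbJ k q m) _))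
      obtain ⟨N', hN'⟩ := ih s y hs h2
      refine ⟨N' + 1 + N, ?_⟩
      have : X 0 ^ (N' + 1 + N) * g = X 0 * ((X 0 ^ N' * y) * pa k)
          + X 0 ^ N' * (pb k q m ^ (n+1) * (X 0 * h)) := by
        rw [pow_add, mul_assoc, e]; ring
      rw [this, pow_succ]
      exact Ideal.add_mem _ (Ideal.mul_mem_left _ _ (Ideal.mul_mem_mul hN' (paJ k q m)))
        (Ideal.mul_mem_left _ _ (Ideal.mul_mem_mul (Ideal.pow_mem_pow (pbJ k q m) _) h1))

lemma sat_p (hq : 1 ≤ q) (hm : 1 ≤ m) (hco : Nat.Coprime (2*q+1) m) (n : ℕ) (s g)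
    (hs : s ∉ curveIdeal k q m) (hsg : s * g ∈ curveIdeal k q m ^ n) :
    ∃ N, X 0 ^ N * g ∈ curveIdeal k q m ^ n := by
  have hprime : (curveIdeal k q m).IsPrime := inferInstance
  have h1 := x0_pow_mul_mem k q m hq hco n hsg
  rw [← mul_assoc] at h1
  obtain ⟨N, hN⟩ := sat_J k q m hq hm hco n (X 0 ^ n * s) g
    (fun h => (hprime.mem_or_mem h).elim
      (fun h => x0_notMem k q m (hprime.mem_of_pow_mem _ h)) hs) h1
  exact ⟨N, Ideal.pow_right_mono (JJ_le k q m) n hN⟩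

end helpers

/-- For all `n ≥ 0`, `𝔭⁽ⁿ⁾ = 𝓘ₙ = Σ_{n₁+2n₂=n} (f)^{n₂}·𝔭^{n₁}`
(for `n = 0` both sides are the unit ideal `R`). -/
theorem statement10 (k : Type*) [Field k] (q m : ℕ) (hq : 1 ≤ q) (hm : 1 ≤ m)
    (hco : Nat.Coprime (2*q+1) m) :
    ∀ n : ℕ, symbPow k q m n = scriptI k q m n := by
  intro n
  apply le_antisymm
  · intro g hg
    rw [mem_symbPow] at hg
    obtain ⟨s, hs, hsg⟩ := hg
    obtain ⟨N, hN⟩ := sat_p k q m hq hm hco n s g hs hsg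
    rw [scriptI_eq k q m hq hm hco]
    refine cancel_pow k q m hq N n g ?_
    rw [← scriptI_eq k q m hq hm hco]
    exact pow_le_scriptI k q m n hN
  · exact scriptI_le k q m hq hm n
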